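/- arXiv:2205.11418 — 2 statements merged into one kernel-verified Lean document; each statement's English description precedes it below -/
import Mathlib

section
/- Let c ∈ F_{2^d} \ F_2 with d = gcd(2i, n) = gcd(i, n) < n, let n be even, and let u be the multiplicative inverse of 2^i + 1 modulo 2^n − 1. Then there exist x, y, a ∈ F_{2^n} such that (x+a)^u + c·x^u = (y+a)^u + c·y^u + c + 1 and tr(x + y) = 1. -/
/-- The absolute trace from `F_{2^n}` to its prime field, computed inside the field. -/
noncomputable def aTr {K : Type} [CommRing K] (n : ℕ) (x : K) : K :=
  ∑ k ∈ Finset.range n, x ^ 2 ^ k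

section TraceForm

variable {F : Type*} [Field F] [Finite F] [Algebra (ZMod 2) F]

local notation "tr" => Algebra.trace (ZMod 2) F

theorem eq_zero_of_trace_mul_eq_zero {k : F} (h : ∀ z, tr (k * z) = 0) : k = 0 :=
  (traceForm_nondegenerate (ZMod 2) F).1 k h

theorem exists_trace_mul_eq (f : F →ₗ[ZMod 2] ZMod 2) : ∃ v : F, ∀ z, f z = tr (v * z) := by
  refine ⟨((Algebra.traceForm (ZMod 2) F).toDual (traceForm_nondegenerate _ _)).symm f,
    fun z => ?_⟩
  rw [← Algebra.traceForm_apply, LinearMap.BilinForm.apply_toDual_symm_apply]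

theorem fixed_of_trace_mul_eq_zero (σ : F ≃ₐ[ZMod 2] F) {k s : F}
    (h : ∀ C, tr (k * (σ C * s + C * σ s)) = 0) : σ (k * (s * σ s)) = k * (s * σ s) := by
  have := charP_of_injective_algebraMap (algebraMap (ZMod 2) F).injective 2
  set κ := k * (s * σ s) with hκ
  have hκZ : ∀ Z, tr ((σ κ - κ) * Z) = 0 := by
    intro Z
    obtain ⟨Y, rfl⟩ := σ.surjective Z
    have h1 := h (s * Y)
    have h2 : k * (σ (s * Y) * s + s * Y * σ s) = κ * Y - κ * σ Y := by
      rw [hκ, map_mul, CharTwo.sub_eq_add]; ring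
    rw [h2, map_sub] at h1
    rw [sub_mul, ← map_mul, map_sub, Algebra.trace_eq_of_algEquiv]
    exact h1
  exact sub_eq_zero.1 (eq_zero_of_trace_mul_eq_zero hκZ)

theorem exists_polar_eq_of_trace (σ : F ≃ₐ[ZMod 2] F) (hσ : ∀ x, σ (σ x) = x → σ x = x)
    {s t : F} (hs : s ≠ 0) (ht : t ≠ 0) (hst : σ (s / t) ≠ s / t)
    (h : ∀ l m, σ l = l → σ m = m →
      l * (t * σ t) + m * (s * σ s) = (s * σ s) * (t * σ t) → tr (l + m) = 1) :
    ∃ C D, σ C * s + C * σ s + s * σ s = σ D * t + D * σ t + t * σ t ∧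
      tr (σ C * s + C * σ s + s * σ s) = 1 := by
  have := charP_of_injective_algebraMap (algebraMap (ZMod 2) F).injective 2
  have hσs : σ s ≠ 0 := by simpa using hs
  have hσt : σ t ≠ 0 := by simpa using ht
  let L (x : F) : F →ₗ[ZMod 2] F :=
    LinearMap.mulRight (ZMod 2) x ∘ₗ σ.toLinearMap + LinearMap.mulRight (ZMod 2) (σ x)
  have hL : ∀ x C, L x C = σ C * x + C * σ x := fun x C => by simp [L]
  let Φ : F × F →ₗ[ZMod 2] F × ZMod 2 :=
    ((L s).coprod (L t)).prod (tr ∘ₗ L s ∘ₗ LinearMap.fst _ _ _)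
  have hΦ : ∀ C D, Φ (C, D) = (L s C + L t D, tr (L s C)) := fun C D => by simp [Φ]
  by_cases hmem : (s * σ s + t * σ t, tr (s * σ s) + 1) ∈ LinearMap.range Φ
  · obtain ⟨⟨C, D⟩, hCD⟩ := hmem
    rw [hΦ, Prod.mk.injEq, hL, hL] at hCD
    obtain ⟨h1, h2⟩ := hCD
    refine ⟨C, D, ?_, ?_⟩
    · rw [← sub_eq_zero, CharTwo.sub_eq_add]
      linear_combination h1 + (s * σ s + t * σ t) * CharTwo.two_eq_zero (R := F)
    · rw [map_add, h2]
      linear_combination tr (s * σ s) * CharTwo.two_eq_zero (R := ZMod 2)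
  · exfalso
    obtain ⟨f, hf, hker⟩ := Submodule.exists_le_ker_of_notMem hmem
    obtain ⟨v, hv⟩ := exists_trace_mul_eq (f ∘ₗ LinearMap.inl _ _ _)
    set ε : ZMod 2 := f (0, 1) with hε
    have hf' : ∀ z e, f (z, e) = tr (v * z) + e * ε := by
      intro z e
      rw [← hv, hε, ← smul_eq_mul, ← map_smul, LinearMap.comp_apply, ← map_add]
      simp
    have hker' : ∀ C D, tr (v * (L s C + L t D)) + tr (L s C) * ε = 0 := fun C D => by
      rw [← hf', ← hΦ]; exact hker ⟨_, rfl⟩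
    have hm := fixed_of_trace_mul_eq_zero σ (k := v) (s := t) fun D => by
      simpa [hL] using hker' 0 D
    have hl := fixed_of_trace_mul_eq_zero σ (k := v + algebraMap _ F ε) (s := s) fun C => by
      have := hker' C 0
      rw [add_mul, ← Algebra.smul_def, map_add, map_smul, smul_eq_mul, mul_comm ε, ← hL]
      simpa using this
    rw [hf'] at hf
    obtain hε0 | hε1 : ε = 0 ∨ ε = 1 := by generalize ε = e; revert e; decide
    · rw [hε0] at hf hl
      simp only [map_zero, add_zero, mul_zero] at hf hl
      have hv0 : v ≠ 0 := fun h0 => hf (by simp [h0])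
      have hquot : σ (s / t * σ (s / t)) = s / t * σ (s / t) := by
        have : s / t * σ (s / t) = v * (s * σ s) / (v * (t * σ t)) := by
          rw [map_div₀]; field_simp
        rw [this, map_div₀, hl, hm]
      rw [map_mul, mul_comm] at hquot
      refine hst (hσ _ (mul_right_cancel₀ (b := σ (s / t)) ?_ hquot))
      simp [hs, ht]
    · rw [hε1] at hf hl
      simp only [map_one] at hl
      have := h _ _ hl hm (by
        linear_combination (v * s * σ s * t * σ t) * CharTwo.two_eq_zero (R := F))
      apply hf
      have e1 : (v + 1) * (s * σ s) + v * (t * σ t) = v * (s * σ s + t * σ t) + s * σ s := by ring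
      rw [e1, map_add] at this
      linear_combination this + CharTwo.two_eq_zero (R := ZMod 2)

end TraceForm

section CubicSubfield

variable {E F : Type*} [Field E] [Field F] [Algebra E F]

open Submodule in
theorem mul_mem_span_of_scaled_mem [CharP F 2] {c : E} (hc0 : c ≠ 0) (hc1 : c ≠ 1) {τ p : F}
    (h : ∀ e : E, e ≠ 0 → (1 + e • τ + e ^ 2 • p) * (1 + (c * e) • τ + (c * e) ^ 2 • p) ∈
      span E {1, τ, p}) :
    τ * τ ∈ span E {1, τ, p} ∧ τ * p ∈ span E {1, τ, p} ∧ p * p ∈ span E {1, τ, p} := by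
  have hE2 : (2 : E) = 0 :=
    (algebraMap E F).injective (by rw [map_ofNat, map_zero, CharTwo.two_eq_zero])
  set W : Submodule E F := span E {1, τ, p} with hW
  have h1 : (1 : F) ∈ W := subset_span (by simp)
  have hτ : τ ∈ W := subset_span (by simp)
  have hp : p ∈ W := subset_span (by simp)
  have hc1' : 1 + c ≠ 0 := fun h0 => hc1 (by linear_combination h0 - hE2)
  have key : ∀ e : E, e ≠ 0 → τ * τ + (e * (1 + c)) • (τ * p) + (e ^ 2 * c) • (p * p) ∈ W := by
    intro e he
    rw [← W.smul_mem_iff (mul_ne_zero (pow_ne_zero 2 he) hc0)]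
    have h2 := W.sub_mem (h e he) (W.add_mem (W.add_mem h1 (W.smul_mem (e * (1 + c)) hτ))
      (W.smul_mem (e ^ 2 * (1 + c ^ 2)) hp))
    convert h2 using 1
    simp only [Algebra.smul_def, map_mul, map_pow, map_add, map_one]
    ring
  have k1 := key 1 one_ne_zero
  have kc := key c hc0
  have kd := key (1 + c) hc1'
  have a1 : τ * p + c • (p * p) ∈ W := by
    rw [← W.smul_mem_iff (pow_ne_zero 2 hc1')]
    convert W.sub_mem kc k1 using 1
    have := congrArg (algebraMap E F) hE2
    simp only [Algebra.smul_def, map_mul, map_pow, map_add, map_one, map_ofNat, map_zero] at this ⊢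
    linear_combination ((algebraMap E F c + 1) * τ * p +
      (algebraMap E F c ^ 2 + algebraMap E F c) * p * p) * this
  have a2 : (1 + c) • (τ * p) + c ^ 2 • (p * p) ∈ W := by
    rw [← W.smul_mem_iff hc0]
    convert W.sub_mem kd k1 using 1
    have := congrArg (algebraMap E F) hE2
    simp only [Algebra.smul_def, map_mul, map_pow, map_add, map_one, map_ofNat, map_zero] at this ⊢
    linear_combination (- algebraMap E F c ^ 2 * p * p) * this
  have a3 : p * p ∈ W := by
    rw [← W.smul_mem_iff hc0]
    convert W.sub_mem (W.smul_mem (1 + c) a1) a2 using 1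
    simp only [Algebra.smul_def, map_pow, map_add, map_one]
    ring
  have a4 : τ * p ∈ W := by
    convert W.sub_mem a1 (W.smul_mem c a3) using 1
    ring
  refine ⟨?_, a4, a3⟩
  convert W.sub_mem (W.sub_mem k1 (W.smul_mem (1 * (1 + c)) a4)) (W.smul_mem (1 ^ 2 * c) a3) using 1
  ring

open Submodule in
theorem exists_intermediateField_of_mul_mem_span [Algebra.IsAlgebraic E F] {τ p : F}
    (h1 : τ * τ ∈ span E {1, τ, p}) (h2 : τ * p ∈ span E {1, τ, p})
    (h3 : p * p ∈ span E {1, τ, p}) :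
    ∃ W : IntermediateField E F, τ ∈ W ∧ p ∈ W ∧ Module.finrank E W ≤ 3 := by
  classical
  have hmul : ∀ x y, x ∈ span E {1, τ, p} → y ∈ span E {1, τ, p} → x * y ∈ span E {1, τ, p} := by
    intro x y hx hy
    have := Submodule.mul_mem_mul hx hy
    rw [span_mul_span] at this
    refine span_le.2 ?_ this
    rintro _ ⟨a, ha, b, hb, rfl⟩
    have g1 : (1 : F) ∈ span E {1, τ, p} := subset_span (by simp)
    have g2 : τ ∈ span E {1, τ, p} := subset_span (by simp)
    have g3 : p ∈ span E {1, τ, p} := subset_span (by simp)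
    rcases ha with rfl | rfl | rfl <;> rcases hb with rfl | rfl | rfl <;>
      simp_all [mul_comm]
  let A : Subalgebra E F := (span E {1, τ, p}).toSubalgebra (subset_span (by simp)) hmul
  refine ⟨subalgebraEquivIntermediateField A, ?_, ?_, ?_⟩
  · exact (mem_subalgebraEquivIntermediateField (S := A)).2 (subset_span (by simp))
  · exact (mem_subalgebraEquivIntermediateField (S := A)).2 (subset_span (by simp))
  · have := finrank_span_finset_le_card (R := E) ({1, τ, p} : Finset F)
    have h3 : ({1, τ, p} : Finset F).card ≤ 3 := Finset.card_le_three
    refine le_trans (le_of_eq ?_) (this.trans h3)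
    simp only [Finset.coe_insert, Finset.coe_singleton]
    rfl

theorem mem_of_quadratic_of_odd_finrank [FiniteDimensional E F] (hodd : Odd (Module.finrank E F))
    (W : IntermediateField E F) {r b c : F} (hb : b ∈ W) (hc : c ∈ W)
    (h : r * r + b * r + c = 0) : r ∈ W := by
  have hint : IsIntegral W r := .of_finite W r
  have hdvd := (minpoly.degree_dvd hint).trans
    (Dvd.intro_left _ (Module.finrank_mul_finrank E W F))
  open Polynomial in
  have hle : (minpoly W r).natDegree ≤ 2 := by
    have hd : (X ^ 2 + C ⟨b, hb⟩ * X + C ⟨c, hc⟩ : W[X]).natDegree = 2 := by compute_degree!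
    rw [← hd]
    refine natDegree_le_of_dvd (minpoly.dvd _ _ ?_) fun h0 => by simp [h0] at hd
    simp only [map_add, map_mul, map_pow, aeval_X, aeval_C, IntermediateField.algebraMap_apply]
    linear_combination h
  have hone : (minpoly W r).natDegree = 1 := by
    have := minpoly.natDegree_pos hint
    interval_cases hn : (minpoly W r).natDegree
    · rfl
    · exact absurd (even_iff_two_dvd.2 hdvd) (Nat.not_even_iff_odd.2 hodd)
  have := minpoly.mem_range_of_degree_eq_one W r
    ((Polynomial.degree_eq_iff_natDegree_eq_of_pos one_pos).2 hone)
  obtain ⟨w, rfl⟩ := this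
  exact w.2

theorem pow_card_cubed_eq_self [Finite F] (hodd : Odd (Module.finrank E F))
    (W : IntermediateField E F) (hW : Module.finrank E W ≤ 3) {r : F} (hr : r ∈ W) :
    r ^ Nat.card E ^ 3 = r := by
  have : Finite E := .of_injective _ (algebraMap E F).injective
  have : Fintype W := .ofFinite W
  have hcard : r ^ Nat.card W = r := by
    rw [Nat.card_eq_fintype_card]
    exact congrArg Subtype.val (FiniteField.pow_card (⟨r, hr⟩ : W))
  rw [Module.natCard_eq_pow_finrank (K := E)] at hcard
  have hpos : 0 < Module.finrank E W := Module.finrank_pos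
  have hdvd : Module.finrank E W ∣ Module.finrank E F :=
    Dvd.intro _ (Module.finrank_mul_finrank E W F)
  interval_cases Module.finrank E W
  · rw [pow_one] at hcard
    simp [pow_succ, pow_mul, hcard]
  · exact absurd (even_iff_two_dvd.2 hdvd) (Nat.not_even_iff_odd.2 hodd)
  · exact hcard

end CubicSubfield

section FrobeniusOrbit

variable {E F : Type*} [Field E] [Field F] [Algebra E F]

theorem mem_range_of_one_add_eq_mul {c : E} (hc1 : c ≠ 1) {r : F} {e : E}
    (h : 1 + r = algebraMap E F e * (1 + algebraMap E F c * r)) :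
    r ∈ Set.range (algebraMap E F) := by
  by_cases hec : e * c = 1
  · have hec' : algebraMap E F e * algebraMap E F c = 1 := by rw [← map_mul, hec, map_one]
    have he : algebraMap E F e = algebraMap E F 1 := by
      rw [map_one]; linear_combination -h - r * hec'
    rw [(algebraMap E F).injective he, one_mul] at hec
    exact absurd hec hc1
  · refine ⟨(e - 1) / (1 - e * c), ?_⟩
    have hne : algebraMap E F (1 - e * c) ≠ 0 :=
      (map_ne_zero _).2 (sub_ne_zero.2 (Ne.symm hec))
    rw [map_div₀, div_eq_iff hne]
    simp only [map_sub, map_mul, map_one]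
    linear_combination -h

theorem one_add_mul_ne_zero_of_notMem_range {r : F} (hr : r ∉ Set.range (algebraMap E F)) (c : E) :
    1 + algebraMap E F c * r ≠ 0 := by
  intro h
  rcases eq_or_ne c 0 with rfl | hc
  · simp at h
  · refine hr ⟨-c⁻¹, ?_⟩
    have hc' : algebraMap E F c ≠ 0 := by simpa using hc
    rw [map_neg, map_inv₀]
    field_simp
    linear_combination -h

theorem eq_zero_of_fixed_relation {σ : F ≃ₐ[E] F}
    (hσ : ∀ x, σ (σ x) = x → x ∈ Set.range (algebraMap E F)) {c : E} (hc1 : c ≠ 1) {r : F}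
    (hr : r ∉ Set.range (algebraMap E F)) {X Y : F} (hX : σ X = X) (hY : σ Y = Y)
    (h : X * ((1 + r) * σ (1 + r)) =
      Y * ((1 + algebraMap E F c * r) * σ (1 + algebraMap E F c * r))) : X = 0 ∧ Y = 0 := by
  set s := 1 + algebraMap E F c * r with hs
  have ht0 : 1 + r ≠ 0 := by simpa using one_add_mul_ne_zero_of_notMem_range hr 1
  have hs0 : s ≠ 0 := one_add_mul_ne_zero_of_notMem_range hr c
  have ht0' : σ (1 + r) ≠ 0 := by rwa [Ne, map_eq_zero_iff _ σ.injective]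
  have hs0' : σ s ≠ 0 := by rwa [Ne, map_eq_zero_iff _ σ.injective]
  have hX0 : X = 0 := by
    by_contra hX0
    set z := (1 + r) / s with hz
    have hN : z * σ z = Y / X := by
      rw [hz, map_div₀]; field_simp; linear_combination h
    have hfix : σ (z * σ z) = z * σ z := by rw [hN, map_div₀, hX, hY]
    have hz0 : σ z ≠ 0 := by rw [hz, map_div₀]; exact div_ne_zero ht0' hs0'
    rw [map_mul, mul_comm] at hfix
    obtain ⟨e, he⟩ := hσ z (mul_right_cancel₀ hz0 hfix)
    rw [hz, eq_div_iff hs0] at he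
    exact hr (mem_range_of_one_add_eq_mul hc1 he.symm)
  refine ⟨hX0, ?_⟩
  rw [hX0, zero_mul, eq_comm] at h
  simpa [hs0, hs0'] using h

theorem add_eq_of_fixed_relation [CharP F 2] {σ : F ≃ₐ[E] F}
    (hσ : ∀ x, σ (σ x) = x → x ∈ Set.range (algebraMap E F)) {c : E} (hc1 : c ≠ 1) {r : F}
    (hr : r ∉ Set.range (algebraMap E F)) (hr3 : σ (σ (σ r)) = r) {l m : F}
    (hl : σ l = l) (hm : σ m = m)
    (h : l * ((1 + r) * σ (1 + r)) +
        m * ((1 + algebraMap E F c * r) * σ (1 + algebraMap E F c * r)) =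
      ((1 + algebraMap E F c * r) * σ (1 + algebraMap E F c * r)) * ((1 + r) * σ (1 + r))) :
    l + m = 1 + algebraMap E F c * (r * σ r + σ r * σ (σ r) + r * σ (σ r)) +
      algebraMap E F (c * (1 + c)) * (r * σ r * σ (σ r)) := by
  have h2 := CharTwo.two_eq_zero (R := F)
  set k := algebraMap E F c with hk
  have hσk : σ k = k := σ.commutes c
  have hk1 : 1 + k ≠ 0 := by
    intro h0
    refine hc1 ((algebraMap E F).injective ?_)
    rw [map_one]; linear_combination h0 - h2
  have h' := h
  simp only [map_add, map_mul, map_one, hσk] at h'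
  obtain ⟨hX, hY⟩ := eq_zero_of_fixed_relation hσ hc1 hr
    (X := (1 + k) * l - (1 + k * r) * (1 + k * σ r) * (1 + k * σ (σ r)))
    (Y := k * ((1 + r) * (1 + σ r) * (1 + σ (σ r))) - (1 + k) * m)
    (by simp only [map_sub, map_add, map_mul, map_one, hσk, hl, hr3]; ring)
    (by simp only [map_sub, map_add, map_mul, map_one, hσk, hm, hr3]; ring)
    (by
      simp only [← hk, map_add, map_mul, map_one, hσk]
      linear_combination (1 + k) * h' -
        ((1 + k * r) * (1 + k * σ r) * (1 + r) * (1 + σ r)) * (k * σ (σ r)) * h2)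
  apply mul_left_cancel₀ hk1
  simp only [map_add, map_mul, map_one, ← hk]
  linear_combination hX - hY + (k * (r + σ r + σ (σ r)) - k ^ 2 * (r * σ r * σ (σ r))) * h2

theorem pow_three_fixed_of_scaled_relation [Finite F] [CharP F 2] {σ : F ≃ₐ[E] F} {j : ℕ}
    (hσ : ∀ x, σ x = x ^ Nat.card E ^ j) (hodd : Odd (Module.finrank E F))
    {c : E} (hc0 : c ≠ 0) (hc1 : c ≠ 1) {r : F}
    (h : ∀ e : E, e ≠ 0 → ∃ l m : E,
      algebraMap E F l * ((1 + algebraMap E F e * r) * σ (1 + algebraMap E F e * r)) +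
        algebraMap E F m * ((1 + algebraMap E F c * (algebraMap E F e * r)) *
          σ (1 + algebraMap E F c * (algebraMap E F e * r))) =
      ((1 + algebraMap E F c * (algebraMap E F e * r)) *
          σ (1 + algebraMap E F c * (algebraMap E F e * r))) *
        ((1 + algebraMap E F e * r) * σ (1 + algebraMap E F e * r))) :
    σ (σ (σ r)) = r := by
  set τ := r + σ r with hτ
  set p := r * σ r with hp
  have hN : ∀ e : E, (1 + algebraMap E F e * r) * σ (1 + algebraMap E F e * r) =
      1 + e • τ + e ^ 2 • p := by
    intro e
    simp only [map_add, map_mul, map_one, AlgEquiv.commutes, Algebra.smul_def, map_pow, hτ, hp]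
    ring
  have hW : ∀ e : E, 1 + e • τ + e ^ 2 • p ∈ Submodule.span E {1, τ, p} := fun e =>
    add_mem (add_mem (Submodule.subset_span (by simp))
      (Submodule.smul_mem _ _ (Submodule.subset_span (by simp))))
      (Submodule.smul_mem _ _ (Submodule.subset_span (by simp)))
  obtain ⟨h1, h2, h3⟩ := mul_mem_span_of_scaled_mem hc0 hc1 (τ := τ) (p := p) fun e he => by
    obtain ⟨l, m, hlm⟩ := h e he
    simp only [← mul_assoc (algebraMap E F c), ← map_mul] at hlm
    rw [hN, hN, ← Algebra.smul_def, ← Algebra.smul_def] at hlm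
    rw [mul_comm, ← hlm]
    exact add_mem (Submodule.smul_mem _ _ (hW e)) (Submodule.smul_mem _ _ (hW (c * e)))
  obtain ⟨W, hτW, hpW, hW3⟩ := exists_intermediateField_of_mul_mem_span h1 h2 h3
  have hrW : r ∈ W := mem_of_quadratic_of_odd_finrank hodd W hτW hpW (by
    rw [hτ, hp]; linear_combination (r * r + r * σ r) * CharTwo.two_eq_zero (R := F))
  have hr := pow_card_cubed_eq_self hodd W hW3 hrW
  have hiter : ∀ k, r ^ (Nat.card E ^ 3) ^ k = r := by
    intro k
    induction k with
    | zero => simp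
    | succ k ih => rw [pow_succ, pow_mul, ih, hr]
  rw [hσ, hσ (σ r), hσ r, ← pow_mul, ← pow_mul]
  convert hiter j using 2
  ring

end FrobeniusOrbit

section Existence

variable {E F : Type*} [Field E] [Field F] [Algebra E F] [Algebra (ZMod 2) E] [Algebra (ZMod 2) F]
  [IsScalarTower (ZMod 2) E F] [Finite F]

theorem exists_sq_add_self_add_one_eq_zero [Finite E] (hE : Even (Module.finrank (ZMod 2) E)) :
    ∃ ω : E, ω ^ 2 + ω + 1 = 0 := by
  have : Fintype E := .ofFinite E
  have : DecidableEq E := Classical.decEq E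
  have hcard : 3 ∣ Fintype.card Eˣ := by
    obtain ⟨k, hk⟩ := hE
    rw [Fintype.card_units, ← Nat.card_eq_fintype_card, Module.natCard_eq_pow_finrank (K := ZMod 2),
      Nat.card_zmod, hk, ← two_mul, pow_mul]
    simpa using Nat.sub_dvd_pow_sub_pow 4 1 k
  have : Fact (Nat.Prime 3) := ⟨Nat.prime_three⟩
  obtain ⟨w, hw⟩ := exists_prime_orderOf_dvd_card 3 hcard
  have hw3 : (w : E) ^ 3 = 1 := by
    rw [← Units.val_pow_eq_pow_val, ← hw, pow_orderOf_eq_one, Units.val_one]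
  have hw1 : (w : E) - 1 ≠ 0 := by
    rw [sub_ne_zero]
    intro h
    rw [Units.val_eq_one.1 h, orderOf_one] at hw
    omega
  exact ⟨w, mul_left_cancel₀ hw1 (by linear_combination hw3)⟩

theorem exists_trace_mul_sq_eq_one (hodd : Odd (Module.finrank E F)) {a : E} (ha : a ≠ 0) :
    ∃ e : E, Algebra.trace (ZMod 2) F (algebraMap E F (a * e ^ 2)) = 1 := by
  have : Finite E := .of_injective _ (algebraMap E F).injective
  have := charP_of_injective_algebraMap (algebraMap (ZMod 2) E).injective 2
  obtain ⟨g, hg⟩ := Algebra.trace_surjective (ZMod 2) E 1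
  obtain ⟨e, he⟩ := FiniteField.isSquare_of_char_two (ringChar.eq E 2) (g / a)
  refine ⟨e, ?_⟩
  rw [sq, ← he, mul_div_cancel₀ _ ha, ← Algebra.trace_trace (S := E), Algebra.trace_algebraMap,
    map_nsmul, hg, nsmul_one, ZMod.natCast_eq_one_iff_odd]
  exact hodd

theorem exists_trace_relation_of_odd_finrank {σ : F ≃ₐ[E] F} {j : ℕ}
    (hσ : ∀ x, σ x = x ^ Nat.card E ^ j)
    (hfix : ∀ x, σ (σ x) = x → x ∈ Set.range (algebraMap E F))
    (hodd : Odd (Module.finrank E F)) (hE : Even (Module.finrank (ZMod 2) E))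
    (hlt : ∃ r : F, r ∉ Set.range (algebraMap E F)) {c : E} (hc0 : c ≠ 0) (hc1 : c ≠ 1) :
    ∃ r ∉ Set.range (algebraMap E F), ∀ l m : E,
      algebraMap E F l * ((1 + r) * σ (1 + r)) +
        algebraMap E F m * ((1 + algebraMap E F c * r) * σ (1 + algebraMap E F c * r)) =
      ((1 + algebraMap E F c * r) * σ (1 + algebraMap E F c * r)) * ((1 + r) * σ (1 + r)) →
      Algebra.trace (ZMod 2) F (algebraMap E F (l + m)) = 1 := by
  have : Finite E := .of_injective _ (algebraMap E F).injective
  have := charP_of_injective_algebraMap (algebraMap (ZMod 2) F).injective 2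
  have h2 := CharTwo.two_eq_zero (R := F)
  by_contra! hbad
  have hscale : ∀ r ∉ Set.range (algebraMap E F), ∀ e : E, e ≠ 0 →
      algebraMap E F e * r ∉ Set.range (algebraMap E F) := by
    rintro r hr e he ⟨f, hf⟩
    have he' : algebraMap E F e ≠ 0 := (map_ne_zero _).2 he
    exact hr ⟨f / e, by rw [map_div₀, hf, mul_div_cancel_left₀ _ he']⟩
  have hcube : ∀ r ∉ Set.range (algebraMap E F), σ (σ (σ r)) = r := fun r hr =>
    pow_three_fixed_of_scaled_relation hσ hodd hc0 hc1 fun e he => by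
      obtain ⟨l, m, hlm, -⟩ := hbad _ (hscale r hr e he)
      exact ⟨l, m, hlm⟩
  have htr1 : Algebra.trace (ZMod 2) F 1 = 0 := by
    rw [← map_one (algebraMap (ZMod 2) F), Algebra.trace_algebraMap, nsmul_one,
      ZMod.natCast_eq_zero_iff_even, ← Module.finrank_mul_finrank (ZMod 2) E F]
    exact hE.mul_right _
  have htr : ∀ r ∉ Set.range (algebraMap E F), Algebra.trace (ZMod 2) F
      (algebraMap E F c * (r * σ r + σ r * σ (σ r) + r * σ (σ r))) +
      Algebra.trace (ZMod 2) F (algebraMap E F (c * (1 + c)) * (r * σ r * σ (σ r))) = 0 := by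
    intro r hr
    obtain ⟨l, m, hlm, hne⟩ := hbad r hr
    rw [map_add, add_eq_of_fixed_relation hfix hc1 hr (hcube r hr) (σ.commutes l) (σ.commutes m)
      hlm, map_add, map_add, htr1, zero_add] at hne
    revert hne
    generalize Algebra.trace (ZMod 2) F _ + Algebra.trace (ZMod 2) F _ = x
    revert x
    decide
  obtain ⟨r, hr, hS⟩ : ∃ r ∉ Set.range (algebraMap E F),
      r * σ r + σ r * σ (σ r) + r * σ (σ r) ≠ 0 := by
    obtain ⟨r, hr⟩ := hlt
    by_cases hS : r * σ r + σ r * σ (σ r) + r * σ (σ r) = 0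
    · refine ⟨r + 1, fun ⟨f, hf⟩ => hr ⟨f - 1, by rw [map_sub, hf, map_one, add_sub_cancel_right]⟩,
        fun h0 => one_ne_zero (α := F) ?_⟩
      simp only [map_add, map_one] at h0
      linear_combination h0 - hS - (1 + r + σ r + σ (σ r)) * h2
    · exact ⟨r, hr, hS⟩
  obtain ⟨S, hSS⟩ := hfix (r * σ r + σ r * σ (σ r) + r * σ (σ r)) (by
    simp only [map_add, map_mul, hcube r hr]; ring)
  rw [← hSS] at hS
  have hS0 : S ≠ 0 := fun h0 => hS (by rw [h0, map_zero])
  obtain ⟨e, he⟩ := exists_trace_mul_sq_eq_one hodd (mul_ne_zero hc0 hS0)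
  have he0 : e ≠ 0 := by
    rintro rfl
    simp at he
  obtain ⟨ω, hω⟩ := exists_sq_add_self_add_one_eq_zero hE
  have hω3 : ω ^ 3 = 1 := by linear_combination (ω - 1) * hω
  have hω0 : ω ≠ 0 := by
    rintro rfl
    simp at hω
  have htre : ∀ f : E, f ≠ 0 → Algebra.trace (ZMod 2) F (algebraMap E F (c * S * f ^ 2)) +
      Algebra.trace (ZMod 2) F
        (algebraMap E F (c * (1 + c) * f ^ 3) * (r * σ r * σ (σ r))) = 0 := by
    intro f hf
    convert htr _ (hscale r hr f hf) using 3
    · simp only [map_mul, map_pow, hSS, AlgEquiv.commutes]; ring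
    · simp only [map_mul, map_pow, AlgEquiv.commutes]; ring
  have t1 := htre (ω * e) (mul_ne_zero hω0 he0)
  have t2 := htre (ω ^ 2 * e) (mul_ne_zero (pow_ne_zero 2 hω0) he0)
  rw [mul_pow ω e 3, hω3, one_mul] at t1
  rw [mul_pow (ω ^ 2) e 3, ← pow_mul, mul_comm 2 3, pow_mul, hω3, one_pow, one_mul] at t2
  have hsum : algebraMap E F (c * S * e ^ 2) + algebraMap E F (c * S * (ω * e) ^ 2) +
      algebraMap E F (c * S * (ω ^ 2 * e) ^ 2) = 0 := by
    rw [← map_add, ← map_add, map_eq_zero_iff _ (algebraMap E F).injective]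
    linear_combination (c * S * e ^ 2) * hω + (c * S * e ^ 2 * ω) * hω3
  have hsum' := congrArg (Algebra.trace (ZMod 2) F) hsum
  rw [map_add, map_add, map_zero] at hsum'
  rw [he] at hsum'
  refine one_ne_zero (α := ZMod 2) ?_
  linear_combination hsum' - t1 - t2 + Algebra.trace (ZMod 2) F
    (algebraMap E F (c * (1 + c) * e ^ 3) * (r * σ r * σ (σ r))) * CharTwo.two_eq_zero (R := ZMod 2)

theorem exists_norm_relation_of_odd_finrank {σ : F ≃ₐ[E] F} {j : ℕ}
    (hσ : ∀ x, σ x = x ^ Nat.card E ^ j)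
    (hfix : ∀ x, σ (σ x) = x → x ∈ Set.range (algebraMap E F))
    (hodd : Odd (Module.finrank E F)) (hE : Even (Module.finrank (ZMod 2) E))
    (hlt : ∃ r : F, r ∉ Set.range (algebraMap E F)) {c : E} (hc0 : c ≠ 0) (hc1 : c ≠ 1) :
    ∃ A B C D : F, A * σ A + B * σ B = C * σ C + D * σ D ∧
      A + algebraMap E F c * B = C + algebraMap E F c * D + algebraMap E F c + 1 ∧
      Algebra.trace (ZMod 2) F (B * σ B + D * σ D) = 1 := by
  have := charP_of_injective_algebraMap (algebraMap (ZMod 2) F).injective 2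
  have h2 := CharTwo.two_eq_zero (R := F)
  have hfix1 : ∀ x, σ x = x → x ∈ Set.range (algebraMap E F) := fun x hx =>
    hfix x (by rw [hx, hx])
  obtain ⟨r, hr, htr⟩ := exists_trace_relation_of_odd_finrank hσ hfix hodd hE hlt hc0 hc1
  set s := 1 + algebraMap E F c * r with hs
  have hs0 : s ≠ 0 := one_add_mul_ne_zero_of_notMem_range hr c
  have ht0 : 1 + r ≠ 0 := by simpa using one_add_mul_ne_zero_of_notMem_range hr 1
  obtain ⟨C, D, hCD, htrC⟩ := exists_polar_eq_of_trace (σ.restrictScalars (ZMod 2))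
    (s := s) (t := 1 + r)
    (fun x hx => by
      obtain ⟨e, rfl⟩ := hfix x hx
      exact σ.commutes e) hs0 ht0
    (fun hst => by
      obtain ⟨e, he⟩ := hfix1 _ hst
      refine hr (mem_range_of_one_add_eq_mul hc1 (e := e⁻¹) ?_)
      rw [map_inv₀, he, ← hs, inv_div, div_mul_cancel₀ _ hs0])
    (fun l m hl hm hlm => by
      obtain ⟨l, rfl⟩ := hfix1 l hl
      obtain ⟨m, rfl⟩ := hfix1 m hm
      rw [← map_add]
      exact htr l m hlm)
  simp only [AlgEquiv.restrictScalars_apply] at hCD htrC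
  refine ⟨C + s, D + (1 + r), C, D, ?_, ?_, ?_⟩
  · rw [map_add σ C, map_add σ D]
    linear_combination hCD + (D * σ (1 + r) + (1 + r) * σ D + (1 + r) * σ (1 + r)) * h2
  · linear_combination hs + (algebraMap E F c * r) * h2
  · rw [hCD] at htrC
    rw [← htrC, map_add σ D]
    congr 1
    linear_combination (D * σ D) * h2

end Existence

section GaloisField

theorem mem_range_algebraMap_of_pow_card_eq {E F : Type*} [Field E] [Field F] [Algebra E F]
    [Finite F] {x : F} (hx : x ^ Nat.card E = x) : x ∈ Set.range (algebraMap E F) := by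
  have : Finite E := .of_injective _ (algebraMap E F).injective
  have : Fintype E := .ofFinite E
  rw [IsGalois.mem_range_algebraMap_iff_fixed]
  intro g
  obtain ⟨k, rfl⟩ := (FiniteField.bijective_frobeniusAlgEquivOfAlgebraic_pow E F).2 g
  rw [AlgEquiv.coe_pow]
  refine Function.iterate_fixed ?_ _
  rw [FiniteField.coe_frobeniusAlgEquivOfAlgebraic, ← Nat.card_eq_fintype_card]
  exact hx

theorem pow_pow_gcd_eq_self {M : Type*} [Monoid M] {p a b : ℕ} {x : M}
    (ha : x ^ p ^ a = x) (hb : x ^ p ^ b = x) : x ^ p ^ Nat.gcd a b = x := by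
  have hper : ∀ k, Function.IsPeriodicPt (fun y : M => y ^ p) k x ↔ x ^ p ^ k = x := fun k => by
    rw [Function.IsPeriodicPt, Function.IsFixedPt, pow_iterate]
  exact (hper _).1 (((hper a).2 ha).gcd ((hper b).2 hb))

theorem pow_eq_self_of_modEq_one {K : Type*} [GroupWithZero K] [Finite K] {k : ℕ} (hk : k ≠ 0)
    (h : k ≡ 1 [MOD Nat.card K - 1]) (x : K) : x ^ k = x := by
  rcases eq_or_ne x 0 with rfl | hx
  · exact zero_pow hk
  · have hx1 : x ^ (Nat.card K - 1) = 1 := by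
      have : Fintype K := .ofFinite K
      rw [Nat.card_eq_fintype_card]
      exact FiniteField.pow_card_sub_one_eq_one x hx
    have hmod := (pow_eq_pow_iff_modEq (x := Units.mk0 x hx) (n := k) (m := 1)).2
      (h.of_dvd (orderOf_dvd_of_pow_eq_one (Units.ext hx1)))
    simpa using congrArg Units.val hmod

theorem odd_div_of_gcd_two_mul_eq {n i d : ℕ} (hn : n ≠ 0) (hd2 : d = Nat.gcd (2 * i) n)
    (hd1 : d = Nat.gcd i n) : Odd (n / d) := by
  have hd0 : 0 < d := hd1 ▸ Nat.gcd_pos_of_pos_right _ (Nat.pos_of_ne_zero hn)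
  have hdi : d ∣ i := hd1 ▸ Nat.gcd_dvd_left _ _
  have hdn : d ∣ n := hd1 ▸ Nat.gcd_dvd_right _ _
  rw [← Nat.not_even_iff_odd, even_iff_two_dvd, Nat.dvd_div_iff_mul_dvd hdn]
  intro h
  have := Nat.dvd_gcd (mul_dvd_mul_left 2 hdi) (mul_comm d 2 ▸ h : 2 * d ∣ n)
  rw [← hd2] at this
  have := Nat.le_of_dvd hd0 this
  omega

theorem aTr_galoisField_eq_algebraMap_trace {n : ℕ} (hn : n ≠ 0) (x : GaloisField 2 n) :
    aTr n x = algebraMap (ZMod 2) _ (Algebra.trace (ZMod 2) (GaloisField 2 n) x) := by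
  rw [FiniteField.algebraMap_trace_eq_sum_pow, GaloisField.finrank 2 hn, Nat.card_zmod, aTr]

end GaloisField

/-- with `c ∈ F_{2^d} \ F_2`, `d = gcd(2i,n) = gcd(i,n) < n`, `n`
even and `u ≡ (2^i+1)^{-1} mod 2^n - 1`, there exist `x, y, a ∈ F_{2^n}` with
`(x+a)^u + c·x^u = (y+a)^u + c·y^u + c + 1` and `tr(x+y) = 1`. -/
theorem stmt15 (n i d u : ℕ) (hne : Even n)
    (hd2 : d = Nat.gcd (2 * i) n) (hd1 : d = Nat.gcd i n) (hdn : d < n)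
    (hu : (2 ^ i + 1) * u ≡ 1 [MOD 2 ^ n - 1])
    (c : GaloisField 2 n) (hc : c ^ 2 ^ d = c) (hc0 : c ≠ 0) (hc1 : c ≠ 1) :
    ∃ x y a : GaloisField 2 n,
      (x + a) ^ u + c * x ^ u = (y + a) ^ u + c * y ^ u + c + 1 ∧
      aTr n (x + y) = 1 := by
  have hn : n ≠ 0 := by omega
  have hd0 : d ≠ 0 := hd1 ▸ (Nat.gcd_pos_of_pos_right _ (Nat.pos_of_ne_zero hn)).ne'
  have hdi : d ∣ i := hd1 ▸ Nat.gcd_dvd_left _ _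
  have hdn' : d ∣ n := hd1 ▸ Nat.gcd_dvd_right _ _
  have hoddq := odd_div_of_gcd_two_mul_eq hn hd2 hd1
  have hdeven : Even d := by
    rw [← Nat.div_mul_cancel hdn', Nat.even_mul] at hne
    exact hne.resolve_left (Nat.not_even_iff_odd.2 hoddq)
  obtain ⟨φ⟩ := FiniteField.nonempty_algHom_of_finrank_dvd (F := ZMod 2) (K := GaloisField 2 d)
    (L := GaloisField 2 n) (by rwa [GaloisField.finrank 2 hd0, GaloisField.finrank 2 hn])
  let := φ.toRingHom.toAlgebra
  have : IsScalarTower (ZMod 2) (GaloisField 2 d) (GaloisField 2 n) :=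
    .of_algebraMap_eq' φ.comp_algebraMap.symm
  have : Fintype (GaloisField 2 d) := .ofFinite _
  have hcard : Nat.card (GaloisField 2 d) = 2 ^ d := GaloisField.card 2 d hd0
  have hcardn : Nat.card (GaloisField 2 n) = 2 ^ n := GaloisField.card 2 n hn
  have hrange : ∀ x : GaloisField 2 n, x ^ 2 ^ d = x →
      x ∈ Set.range (algebraMap (GaloisField 2 d) (GaloisField 2 n)) := fun x hx =>
    mem_range_algebraMap_of_pow_card_eq (by rwa [hcard])
  let σ := FiniteField.frobeniusAlgEquivOfAlgebraic (GaloisField 2 d) (GaloisField 2 n) ^ (i / d)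
  have hσ : ∀ x, σ x = x ^ Nat.card (GaloisField 2 d) ^ (i / d) := fun x => by
    rw [AlgEquiv.coe_pow, FiniteField.coe_frobeniusAlgEquivOfAlgebraic_iterate,
      Nat.card_eq_fintype_card]
  have hσi : ∀ x, σ x = x ^ 2 ^ i := fun x => by
    rw [hσ, hcard, ← pow_mul, Nat.mul_div_cancel' hdi]
  have hpow : ∀ x : GaloisField 2 n, x ^ 2 ^ n = x := fun x => by
    have : Fintype (GaloisField 2 n) := .ofFinite _
    rw [← hcardn, Nat.card_eq_fintype_card, FiniteField.pow_card]
  have hfinrank : Module.finrank (GaloisField 2 d) (GaloisField 2 n) = n / d := by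
    have := Module.finrank_mul_finrank (ZMod 2) (GaloisField 2 d) (GaloisField 2 n)
    rw [GaloisField.finrank 2 hd0, GaloisField.finrank 2 hn] at this
    exact (Nat.div_eq_of_eq_mul_right (Nat.pos_of_ne_zero hd0) this.symm).symm
  obtain ⟨c, rfl⟩ := hrange c hc
  obtain ⟨A, B, C, D, hN, hlin, htr⟩ := exists_norm_relation_of_odd_finrank hσ
    (fun x hx => hrange x (by
      rw [hd2]
      refine pow_pow_gcd_eq_self ?_ (hpow x)
      rwa [hσi, hσi, ← pow_mul, ← pow_add, ← two_mul] at hx))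
    (hfinrank ▸ hoddq) (by rwa [GaloisField.finrank 2 hd0])
    (by
      by_contra! hsurj
      have := Nat.card_le_card_of_surjective _ hsurj
      rw [hcard, hcardn] at this
      exact this.not_gt (Nat.pow_lt_pow_right one_lt_two hdn))
    (c := c) (by rintro rfl; simp at hc0) (by rintro rfl; simp at hc1)
  have hroot : ∀ z : GaloisField 2 n, (z * σ z) ^ u = z := fun z => by
    rw [hσi, ← pow_succ', ← pow_mul]
    refine pow_eq_self_of_modEq_one (fun h0 => ?_) (by rwa [hcardn]) z
    have h4 : 2 ^ 2 ≤ 2 ^ n := Nat.pow_le_pow_right two_pos (by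
      obtain ⟨k, hk⟩ := hne; omega)
    rw [h0, Nat.ModEq, Nat.zero_mod, Nat.mod_eq_of_lt (by omega)] at hu
    omega
  refine ⟨B * σ B, D * σ D, A * σ A + B * σ B, ?_, ?_⟩
  · have h1 : B * σ B + (A * σ A + B * σ B) = A * σ A := by
      linear_combination (B * σ B) * CharTwo.two_eq_zero (R := GaloisField 2 n)
    have h2 : D * σ D + (A * σ A + B * σ B) = C * σ C := by
      linear_combination hN + (D * σ D) * CharTwo.two_eq_zero (R := GaloisField 2 n)
    rw [h1, h2, hroot, hroot, hroot, hroot, hlin]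
  · rw [aTr_galoisField_eq_algebraMap_trace hn, htr, map_one]
end

section
/- Let c ∈ F_{2^d} \ F_2 with d = gcd(2i, n) = gcd(i, n) < n, let n = dm be even, and let u be the multiplicative inverse of 2^i + 1 modulo 2^n − 1. Then F(x) = x^u + tr(x) is a permutation of F_{2^n} whose c-differential uniformity equals 2 (i.e., F is an APcN permutation); equivalently, x^{(2^{im}+1)/(2^i+1)} + tr(x) is an APcN permutation of F_{2^n}. -/
/-- The `c`-differential uniformity of `F`. -/
noncomputable def cDelta {K : Type} [Field K] (c : K) (F : K → K) : ℕ :=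
  sSup { k : ℕ | ∃ a b : K, (c = 1 → a ≠ 0) ∧
    k = Nat.card {x : K // F (x + a) + c * F x = b} }

/-- An element fixed by the Frobenius of a finite subfield lies in that subfield. -/
theorem mem_range_algebraMap_of_pow_natCard_eq {k K : Type*} [Field k] [Field K] [Finite K]
    [Algebra k K] {x : K} (hx : x ^ Nat.card k = x) : x ∈ Set.range (algebraMap k K) := by
  have : Finite k := Finite.of_injective _ (algebraMap k K).injective
  have : Fintype k := Fintype.ofFinite k
  rw [IsGalois.mem_range_algebraMap_iff_fixed]
  intro f
  obtain ⟨j, rfl⟩ := (FiniteField.bijective_frobeniusAlgEquivOfAlgebraic_pow k K).2 f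
  rw [AlgEquiv.coe_pow]
  refine Function.iterate_fixed ?_ _
  rw [FiniteField.coe_frobeniusAlgEquivOfAlgebraic]
  simpa [Nat.card_eq_fintype_card] using hx

/-- The additive form of Hilbert's Theorem 90, for an automorphism whose fixed field is `k`. -/
theorem exists_sub_eq_of_trace_eq_zero {k K : Type*} [Field k] [Field K] [Algebra k K]
    [FiniteDimensional k K] [Algebra.IsSeparable k K] (σ : K ≃ₐ[k] K)
    (hσ : ∀ x, σ x = x → x ∈ Set.range (algebraMap k K)) {w : K}
    (hw : Algebra.trace k K w = 0) : ∃ v, σ v - v = w := by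
  let D : K →ₗ[k] K := σ.toLinearMap - LinearMap.id
  have hle : LinearMap.range D ≤ LinearMap.ker (Algebra.trace k K) := by
    rintro _ ⟨v, rfl⟩
    simp [D, Algebra.trace_eq_of_algEquiv]
  have hker : LinearMap.ker D ≤ Submodule.span k {(1 : K)} := by
    intro x hx
    obtain ⟨a, rfl⟩ := hσ x (by simpa [D, sub_eq_zero] using hx)
    exact Submodule.mem_span_singleton.2 ⟨a, by simp [Algebra.smul_def]⟩
  have hker' := (Submodule.finrank_mono hker).trans_eq (finrank_span_singleton one_ne_zero)
  have hD := LinearMap.finrank_range_add_finrank_ker D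
  have hT := LinearMap.finrank_range_add_finrank_ker (Algebra.trace k K)
  rw [LinearMap.range_eq_top.2 (Algebra.trace_surjective k K), finrank_top,
    Module.finrank_self] at hT
  have heq := Submodule.eq_of_le_of_finrank_le hle (by omega)
  have hmem : w ∈ LinearMap.range D := heq ▸ hw
  simpa [D] using hmem

/-- Prescribing the traces of the multiples of a linearly independent family. -/
theorem exists_trace_mul_eq_s16 {k K ι : Type*} [Field k] [Field K] [Algebra k K]
    [FiniteDimensional k K] [Algebra.IsSeparable k K] {v : ι → K} (hv : LinearIndependent k v)
    (t : ι → k) : ∃ s, ∀ j, Algebra.trace k K (s * v j) = t j := by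
  let b := Module.Basis.span hv
  obtain ⟨f, hf⟩ := (b.constr k t).exists_extend
  refine ⟨((Algebra.traceForm k K).toDual (traceForm_nondegenerate k K)).symm f, fun j ↦ ?_⟩
  rw [← Algebra.traceForm_apply, LinearMap.BilinForm.apply_toDual_symm_apply]
  have := congrArg (· (b j)) hf
  simp only [LinearMap.comp_apply, b.constr_basis] at this
  rw [← this, Submodule.subtype_apply, Module.Basis.span_apply]

theorem trace_algebraMap_of_odd {k K : Type*} [Field k] [Field K] [Algebra k K] [CharP k 2]
    (hodd : Odd (Module.finrank k K)) (a : k) : Algebra.trace k K (algebraMap k K a) = a := by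
  obtain ⟨r, hr⟩ := hodd
  rw [Algebra.trace_algebraMap, hr, add_smul, mul_smul, two_nsmul, CharTwo.add_self_eq_zero,
    one_smul, zero_add]

theorem trace_pow_two {k : Type*} [Field k] [Finite k] [Algebra (ZMod 2) k] (x : k) :
    Algebra.trace (ZMod 2) k (x ^ 2) = Algebra.trace (ZMod 2) k x := by
  have h := Algebra.trace_eq_of_algEquiv (FiniteField.frobeniusAlgEquivOfAlgebraic (ZMod 2) k) x
  rw [FiniteField.coe_frobeniusAlgEquivOfAlgebraic] at h
  simpa using h

/-- If `t ↦ tr (κ t³)` vanishes identically, then `κ` is `0` or `1`. -/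
theorem eq_one_of_trace_mul_cube_eq_zero {k : Type*} [Field k] [Finite k] [CharP k 2]
    [Algebra (ZMod 2) k]
    {κ : k} (hκ : κ ≠ 0) (h : ∀ t, Algebra.trace (ZMod 2) k (κ * t ^ 3) = 0) : κ = 1 := by
  by_contra hne
  have hne' : κ + κ ^ 2 ≠ 0 := by
    intro h0
    refine hne (mul_left_cancel₀ hκ ?_)
    linear_combination h0 - κ * CharTwo.two_eq_zero (R := k)
  refine hne' ((traceForm_nondegenerate (ZMod 2) k).1 _ fun x ↦ ?_)
  obtain ⟨s, rfl⟩ : ∃ s, s ^ 2 = x := (PerfectRing.bijective_frobenius (p := 2)).2 x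
  have hexp : κ * (s + 1) ^ 3 = κ * s ^ 3 + κ * 1 ^ 3 + κ * s ^ 2 + κ * s := by
    linear_combination κ * (s ^ 2 + s) * CharTwo.two_eq_zero (R := k)
  have htr := congrArg (Algebra.trace (ZMod 2) k) hexp
  simp only [map_add, h, zero_add] at htr
  rw [← trace_pow_two (κ * s)] at htr
  rw [Algebra.traceForm_apply, add_mul, map_add, ← mul_pow]
  exact htr.symm

/-- The data from which two solutions of a `c`-differential equation are built. -/
def HasTracePair (k : Type*) {K : Type*} [Field k] [Field K] [Algebra k K]
    [Algebra (ZMod 2) K] (σ : K → K) (c : K) : Prop :=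
  ∃ y z s : K, y ≠ 0 ∧ z ≠ 0 ∧ z + 1 = c * (y + 1) ∧
    Algebra.trace k K (s * (y * σ y)⁻¹) = 1 ∧ Algebra.trace k K (s * (z * σ z)⁻¹) = 1 ∧
    Algebra.trace (ZMod 2) K s = 1

/-- Outside the cubic case, the inverses of `y σ(y)`, `z σ(z)` and `1` are independent over `k`. -/
theorem linearIndependent_inv_mul_apply {k K : Type*} [Field k] [Field K] [Algebra k K]
    [CharP K 2] (σ : K ≃ₐ[k] K)
    (hσ : ∀ x, σ (σ x) = x → x ∈ Set.range (algebraMap k K)) {c : k} (hc0 : c ≠ 0) (hc1 : c ≠ 1)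
    {y z : K} (hy : σ (σ (σ y)) ≠ y) (hz : z + 1 = algebraMap k K c * (y + 1))
    (hy0 : y ≠ 0) (hz0 : z ≠ 0) :
    LinearIndependent k ![(y * σ y)⁻¹, (z * σ z)⁻¹, 1] := by
  have two : (2 : K) = 0 := CharTwo.two_eq_zero
  set C := algebraMap k K c with hC
  have hC1 : C + 1 ≠ 0 := by
    intro h
    apply hc1
    apply (algebraMap k K).injective
    rw [map_one]
    linear_combination h - two
  have hC0 : C ≠ 0 := by simpa [hC] using hc0
  have hzy : z = C * y + (C + 1) := by linear_combination hz - two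
  have hσz (x w : K) (h : w = C * x + (C + 1)) : σ w = C * σ x + (C + 1) := by
    rw [h]; simp [hC]
  have hz1 := hσz _ _ hzy
  have hz2 := hσz _ _ hz1
  have hz3 := hσz _ _ hz2
  have hyy : σ (σ y) + y ≠ 0 := by
    intro h
    obtain ⟨r, rfl⟩ := hσ y (by linear_combination h - y * two)
    simp at hy
  have hσ0 {x : K} (hx : x ≠ 0) : σ x ≠ 0 := by simpa using hx
  have hy1 := hσ0 hy0
  have hy2 := hσ0 hy1
  have hz1' := hσ0 hz0
  have hz2' := hσ0 hz1'
  rw [Fintype.linearIndependent_iff]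
  intro g hg
  simp only [Fin.sum_univ_three, Matrix.cons_val_zero, Matrix.cons_val_one, Matrix.cons_val,
    Algebra.smul_def, mul_one] at hg
  have hrel : algebraMap k K (g 0) * (z * σ z) + algebraMap k K (g 1) * (y * σ y) +
      algebraMap k K (g 2) * (y * σ y * (z * σ z)) = 0 := by
    field_simp at hg
    linear_combination hg
  have hrelσ := congrArg σ hrel
  simp only [map_add, map_mul, AlgEquiv.commutes, map_zero] at hrelσ
  have helim : algebraMap k K (g 0) * (z * σ z * σ (σ z)) +
      algebraMap k K (g 1) * C * (y * σ y * σ (σ y)) = 0 := by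
    have hzz : σ (σ z) + z = C * (σ (σ y) + y) := by
      linear_combination hz2 + hzy + (C + 1) * two
    refine (mul_eq_zero.1 ?_).resolve_right hyy
    linear_combination σ (σ y) * σ (σ z) * hrel + y * z * hrelσ
      - algebraMap k K (g 1) * (y * σ y * σ (σ y)) * hzz
      - σ y * σ z * σ (σ y) * σ (σ z) * y * z * algebraMap k K (g 2) * two
  have helimσ := congrArg σ helim
  simp only [map_add, map_mul, AlgEquiv.commutes, map_zero, hC] at helimσ
  rw [← hC] at helimσ
  have h0 : algebraMap k K (g 0) = 0 := by
    by_contra hα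
    have hcross : z * σ (σ (σ y)) = σ (σ (σ z)) * y := by
      have : (algebraMap k K (g 0) * (σ y * σ (σ y) * σ z * σ (σ z))) ≠ 0 := by
        simp only [ne_eq, mul_eq_zero, hα, hy1, hy2, hz1', hz2', or_self, not_false_eq_true]
      apply mul_left_cancel₀ this
      linear_combination σ y * σ (σ y) * σ (σ (σ y)) * helim - y * σ y * σ (σ y) * helimσ
    rw [hz3, hzy] at hcross
    exact hy (mul_left_cancel₀ hC1 (by linear_combination hcross))
  have h1 : algebraMap k K (g 1) = 0 := by
    rw [h0, zero_mul, zero_add] at helim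
    simpa [hC0, hy0, hy1, hy2] using helim
  have h2 : algebraMap k K (g 2) = 0 := by simpa [h0, h1] using hg
  intro j
  fin_cases j <;> exact (map_eq_zero (algebraMap k K)).1 ‹_›

theorem hasTracePair_of_apply_ne {k K : Type*} [Field k] [Field K] [Finite K] [Algebra k K]
    [CharP K 2] [Algebra (ZMod 2) k] [Algebra (ZMod 2) K] [IsScalarTower (ZMod 2) k K]
    (σ : K ≃ₐ[k] K)
    (hσ : ∀ x, σ (σ x) = x → x ∈ Set.range (algebraMap k K)) {c : k} (hc0 : c ≠ 0) (hc1 : c ≠ 1)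
    {y : K} (hy : σ (σ (σ y)) ≠ y) : HasTracePair k σ (algebraMap k K c) := by
  have : Finite k := Finite.of_injective _ (algebraMap k K).injective
  have hne (a : k) : y ≠ algebraMap k K a := by
    rintro rfl
    simp at hy
  have hy0 : y ≠ 0 := by simpa using hne 0
  have hz0 : algebraMap k K c * (y + 1) - 1 ≠ 0 := by
    intro h
    refine hne (c⁻¹ - 1) ?_
    have hC0 : algebraMap k K c ≠ 0 := by simpa using hc0
    rw [map_sub, map_one, map_inv₀]
    field_simp
    linear_combination h
  have hli := linearIndependent_inv_mul_apply σ hσ hc0 hc1 hy (sub_add_cancel _ 1) hy0 hz0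
  obtain ⟨τ, hτ⟩ := Algebra.trace_surjective (ZMod 2) k 1
  obtain ⟨s, hs⟩ := exists_trace_mul_eq_s16 hli ![1, 1, τ]
  refine ⟨y, _, s, hy0, hz0, sub_add_cancel _ 1, hs 0, hs 1, ?_⟩
  have h2 := hs 2
  simp only [Matrix.cons_val, mul_one] at h2
  rw [← Algebra.trace_trace (S := k), h2, hτ]

theorem hasTracePair_of_cube_mem {k K : Type*} [Field k] [Field K] [Finite K] [Algebra k K]
    [CharP K 2] [Algebra (ZMod 2) k] [Algebra (ZMod 2) K] [IsScalarTower (ZMod 2) k K]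
    (σ : K ≃ₐ[k] K)
    (hσ : ∀ x, σ x = x → x ∈ Set.range (algebraMap k K))
    (hodd : Odd (Module.finrank k K))
    (hunity : ∀ x : K, x ^ 3 = 1 → x ∈ Set.range (algebraMap k K))
    {c : k} {θ : K} (hθ : θ ∉ Set.range (algebraMap k K)) {g : k} (hg : θ ^ 3 = algebraMap k K g)
    (htr : Algebra.trace (ZMod 2) k (c * (c + 1) * g) = 1) :
    HasTracePair k σ (algebraMap k K c) := by
  have : Finite k := Finite.of_injective _ (algebraMap k K).injective
  have : CharP k 2 := (Algebra.charP_iff k K 2).2 ‹_›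
  have two : (2 : K) = 0 := CharTwo.two_eq_zero
  have hθ0 : θ ≠ 0 := by
    rintro rfl
    exact hθ ⟨0, map_zero _⟩
  have hω3 : (σ θ / θ) ^ 3 = 1 := by
    rw [div_pow, ← map_pow, hg, AlgEquiv.commutes, ← hg, div_self (pow_ne_zero 3 hθ0)]
  obtain ⟨ω, hω⟩ := hunity _ hω3
  have hσθ : σ θ = algebraMap k K ω * θ := by rw [hω, div_mul_cancel₀ _ hθ0]
  have hω1 : ω ≠ 1 := by
    rintro rfl
    exact hθ (hσ θ (by simpa using hσθ))
  have hω3' : ω ^ 3 = 1 := (algebraMap k K).injective (by rw [map_pow, hω, hω3, map_one])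
  have hωsum : ω ^ 2 + ω + 1 = 0 := by
    refine (mul_eq_zero.1 ?_).resolve_left (sub_ne_zero.2 hω1)
    linear_combination hω3'
  have hσθ2 : σ (θ ^ 2) = algebraMap k K (ω ^ 2) * θ ^ 2 := by
    rw [map_pow, hσθ, map_pow]; ring
  have htrace {x : K} {a : k} (ha : a ≠ 1) (hx : σ x = algebraMap k K a * x) :
      Algebra.trace k K x = 0 := by
    have h := Algebra.trace_eq_of_algEquiv σ x
    rw [hx, ← Algebra.smul_def, map_smul, smul_eq_mul] at h
    refine (mul_eq_zero.1 ?_).resolve_left (sub_ne_zero.2 ha)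
    linear_combination h
  have hω21 : ω ^ 2 ≠ 1 := by
    intro h
    apply hω1
    linear_combination hω3' - ω * h
  have hcomb (a b e : k) : Algebra.trace k K (algebraMap k K a + algebraMap k K b * θ +
      algebraMap k K e * θ ^ 2) = a := by
    rw [map_add, map_add, trace_algebraMap_of_odd hodd, ← Algebra.smul_def, ← Algebra.smul_def,
      map_smul, map_smul, htrace hω1 hσθ, htrace hω21 hσθ2]
    simp
  have hne (r : k) : 1 + algebraMap k K r * θ ≠ 0 := by
    intro h
    have hr : r ≠ 0 := by
      rintro rfl
      simp at h
    refine hθ ⟨-r⁻¹, ?_⟩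
    have : algebraMap k K r ≠ 0 := by simpa using hr
    rw [map_neg, map_inv₀]
    field_simp
    linear_combination -h
  have hne3 (r : k) : 1 + r ^ 3 * g ≠ 0 := by
    intro h
    have h' := congrArg (algebraMap k K) h
    simp only [map_add, map_mul, map_pow, map_one, map_zero, ← hg] at h'
    obtain ⟨e, he⟩ := hunity (algebraMap k K r * θ)
      (by linear_combination h' - two)
    have hr : algebraMap k K r ≠ 0 := by
      intro hr
      simp [hr] at h'
    exact hθ ⟨r⁻¹ * e, by rw [map_mul, map_inv₀, he, inv_mul_cancel_left₀ hr]⟩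
  have hinv (r : k) : ((1 + algebraMap k K r * θ) * σ (1 + algebraMap k K r * θ))⁻¹ =
      algebraMap k K (1 + r ^ 3 * g)⁻¹ * (1 + algebraMap k K (r * ω ^ 2) * θ) := by
    have h3 : algebraMap k K (1 + r ^ 3 * g) ≠ 0 := by
      rw [ne_eq, map_eq_zero]
      exact hne3 r
    refine inv_eq_of_mul_eq_one_right ?_
    rw [map_inv₀, mul_left_comm, inv_mul_eq_one₀ h3]
    have hsum := congrArg (algebraMap k K) hωsum
    have hω3K := congrArg (algebraMap k K) hω3'
    simp only [map_add, map_mul, map_pow, map_one, map_zero, hσθ, AlgEquiv.commutes,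
      ← hg] at hsum hω3K ⊢
    linear_combination - algebraMap k K r * θ * hsum
      - algebraMap k K r ^ 3 * θ ^ 3 * hω3K
      - algebraMap k K r ^ 2 * θ ^ 2 * algebraMap k K ω * hsum
  have hs (r : k) (hr : r = 1 ∨ r = c) : Algebra.trace k K
      ((algebraMap k K (1 + c * (c + 1) * g) + algebraMap k K ((1 + c * (c + 1)) * ω) * θ ^ 2) *
        ((1 + algebraMap k K r * θ) * σ (1 + algebraMap k K r * θ))⁻¹) = 1 := by
    rw [hinv, mul_left_comm, ← Algebra.smul_def, map_smul, smul_eq_mul, inv_mul_eq_one₀ (hne3 r)]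
    have hexp := hcomb (1 + r ^ 3 * g) ((1 + c * (c + 1) * g) * (r * ω ^ 2))
      ((1 + c * (c + 1)) * ω)
    rw [← hexp]
    congr 1
    have hval : 1 + r ^ 3 * g = 1 + c * (c + 1) * g + (1 + c * (c + 1)) * (r * g) := by
      rcases hr with rfl | rfl
      · linear_combination -c * (c + 1) * g * CharTwo.two_eq_zero (R := k)
      · linear_combination -(r ^ 2 + r) * g * CharTwo.two_eq_zero (R := k)
    rw [hval]
    have hω3K := congrArg (algebraMap k K) hω3'
    simp only [map_add, map_mul, map_pow, map_one, ← hg] at hω3K ⊢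
    linear_combination -(1 + algebraMap k K c * (algebraMap k K c + 1)) * algebraMap k K r *
      θ ^ 3 * hω3K
  refine ⟨1 + algebraMap k K 1 * θ, 1 + algebraMap k K c * θ, _, hne 1, hne c, ?_,
    hs 1 (.inl rfl), hs c (.inr rfl), ?_⟩
  · rw [map_one]
    linear_combination two - algebraMap k K c * two
  · have h := hcomb (1 + c * (c + 1) * g) 0 ((1 + c * (c + 1)) * ω)
    rw [map_zero, zero_mul, add_zero] at h
    rw [← Algebra.trace_trace (S := k), h, map_add, htr]
    have hone : (1 : k) = ω ^ 2 + ω := by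
      linear_combination -hωsum + CharTwo.two_eq_zero (R := k)
    rw [hone, map_add, trace_pow_two, CharTwo.add_self_eq_zero, zero_add]

/-- If `K` contains a cube root outside `k` of an element of `k`, then it contains one for which
the cube `g` satisfies `tr (κ g) = 1`. -/
theorem exists_cube_mem_trace_eq_one {k K : Type*} [Field k] [Field K] [Finite K] [Algebra k K]
    [CharP K 2] [Algebra (ZMod 2) k]
    (hunity : ∀ x : K, x ^ 3 = 1 → x ∈ Set.range (algebraMap k K))
    {κ : k} (hκ : κ ≠ 0) {θ : K} (hθ : θ ∉ Set.range (algebraMap k K))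
    (hθ3 : θ ^ 3 ∈ Set.range (algebraMap k K)) :
    ∃ θ' ∉ Set.range (algebraMap k K), ∃ g, θ' ^ 3 = algebraMap k K g ∧
      Algebra.trace (ZMod 2) k (κ * g) = 1 := by
  have : Finite k := Finite.of_injective _ (algebraMap k K).injective
  have : CharP k 2 := (Algebra.charP_iff k K 2).2 ‹_›
  by_contra! hcon
  have key {η : K} {g : k} (hη : η ∉ Set.range (algebraMap k K)) (hg : algebraMap k K g = η ^ 3) :
      κ * g = 1 := by
    have hg0 : g ≠ 0 := by
      rintro rfl
      rw [map_zero, eq_comm, pow_eq_zero_iff three_ne_zero] at hg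
      exact hη ⟨0, by rw [map_zero, hg]⟩
    refine eq_one_of_trace_mul_cube_eq_zero (mul_ne_zero hκ hg0) fun t ↦ ?_
    by_cases ht : t = 0
    · simp [ht]
    have hmem : algebraMap k K t * η ∉ Set.range (algebraMap k K) := by
      rintro ⟨e, he⟩
      have ht' : algebraMap k K t ≠ 0 := by simpa using ht
      exact hη ⟨t⁻¹ * e, by rw [map_mul, map_inv₀, he, inv_mul_cancel_left₀ ht']⟩
    have h := hcon _ hmem (g * t ^ 3) (by rw [map_mul, map_pow, hg]; ring)
    rw [← mul_assoc] at h
    generalize Algebra.trace (ZMod 2) k (κ * g * t ^ 3) = e at h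
    revert h
    revert e
    decide
  obtain ⟨g, hg⟩ := hθ3
  have hθ2 : θ ^ 2 ∉ Set.range (algebraMap k K) := by
    rintro ⟨e, he⟩
    have he0 : algebraMap k K e ≠ 0 := by
      rw [he]
      rintro h
      rw [pow_eq_zero_iff two_ne_zero] at h
      exact hθ ⟨0, by rw [map_zero, h]⟩
    refine hθ ⟨g / e, ?_⟩
    rw [map_div₀, div_eq_iff he0, hg, he]
    ring
  have h1 := key hθ hg
  have h2 := key (g := g ^ 2) hθ2 (by rw [map_pow, hg]; ring)
  have hg1 : g = 1 := by linear_combination h2 - g * h1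
  exact hθ (hunity θ (by rw [← hg, hg1, map_one]))

/-- A cubic extension of finite fields whose base contains the cube roots of unity is generated by
a cube root. -/
theorem exists_notMem_range_cube_mem {k K : Type*} [Field k] [Field K] [Finite K] [Algebra k K]
    (h3 : Module.finrank k K = 3) (hk : 3 ∣ Nat.card k - 1) :
    ∃ θ : K, θ ∉ Set.range (algebraMap k K) ∧ θ ^ 3 ∈ Set.range (algebraMap k K) := by
  have : Finite k := Finite.of_injective _ (algebraMap k K).injective
  have : Fintype k := Fintype.ofFinite k
  have hcard : Nat.card K = Nat.card k ^ 3 := by rw [Module.natCard_eq_pow_finrank (K := k), h3]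
  have hone : 1 < Nat.card k := Finite.one_lt_card
  obtain ⟨ζ, hζ⟩ := IsCyclic.exists_generator (α := Kˣ)
  have hord : orderOf ζ = Nat.card k ^ 3 - 1 := by
    rw [orderOf_eq_card_of_forall_mem_zpowers hζ, Nat.card_units, hcard]
  obtain ⟨r, hr⟩ := hk
  obtain ⟨w, hw⟩ : ∃ w, w = 3 * r ^ 2 + 3 * r + 1 := ⟨_, rfl⟩
  have hQ : Nat.card k = 3 * r + 1 := by omega
  have hfac : Nat.card k ^ 3 - 1 = 3 * w * (Nat.card k - 1) := by
    rw [hr, hQ, hw]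
    apply Nat.sub_eq_of_eq_add
    ring
  refine ⟨((ζ ^ w : Kˣ) : K), ?_, ?_⟩
  · rintro ⟨a, ha⟩
    have ha0 : a ≠ 0 := by
      rintro rfl
      rw [map_zero] at ha
      exact (ζ ^ w).ne_zero ha.symm
    have h1 : ζ ^ (w * (Nat.card k - 1)) = 1 := by
      ext
      rw [pow_mul, Units.val_pow_eq_pow_val, ← ha, ← map_pow, Nat.card_eq_fintype_card,
        FiniteField.pow_card_sub_one_eq_one a ha0, map_one, Units.val_one]
    have hdvd := orderOf_dvd_of_pow_eq_one h1
    rw [hord, hfac] at hdvd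
    have hpos : 0 < w * (Nat.card k - 1) := Nat.mul_pos (by omega) (by omega)
    have := Nat.le_of_dvd hpos hdvd
    rw [mul_assoc] at this
    omega
  · apply mem_range_algebraMap_of_pow_natCard_eq
    have h1 : ζ ^ (3 * w * (Nat.card k - 1)) = 1 := by rw [← hfac, ← hord, pow_orderOf_eq_one]
    have h2 : ((ζ ^ w) ^ 3) ^ Nat.card k = (ζ ^ w) ^ 3 := by
      conv_lhs => rw [← Nat.sub_add_cancel hone.le, pow_succ, ← pow_mul ζ w 3, ← pow_mul,
        mul_comm w 3, h1, one_mul]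
      rw [← pow_mul, mul_comm]
    exact congrArg Units.val h2

theorem hasTracePair_of_odd_finrank {k K : Type*} [Field k] [Field K] [Finite K] [Algebra k K]
    [CharP K 2] [Algebra (ZMod 2) k] [Algebra (ZMod 2) K] [IsScalarTower (ZMod 2) k K] [Fintype k]
    (hodd : Odd (Module.finrank k K)) (hone : Module.finrank k K ≠ 1)
    (hk : 3 ∣ Nat.card k - 1) {j : ℕ} (hj : j.Coprime (Module.finrank k K))
    (hσ : ∀ x, ((FiniteField.frobeniusAlgEquivOfAlgebraic k K) ^ j) x = x →
      x ∈ Set.range (algebraMap k K))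
    (hσ2 : ∀ x, ((FiniteField.frobeniusAlgEquivOfAlgebraic k K) ^ j)
      (((FiniteField.frobeniusAlgEquivOfAlgebraic k K) ^ j) x) = x →
        x ∈ Set.range (algebraMap k K)) {c : k} (hc0 : c ≠ 0) (hc1 : c ≠ 1) :
    HasTracePair k ((FiniteField.frobeniusAlgEquivOfAlgebraic k K) ^ j) (algebraMap k K c) := by
  set σ := (FiniteField.frobeniusAlgEquivOfAlgebraic k K) ^ j with hσdef
  have : CharP k 2 := (Algebra.charP_iff k K 2).2 ‹_›
  by_cases hex : ∃ y, σ (σ (σ y)) ≠ y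
  · obtain ⟨y, hy⟩ := hex
    exact hasTracePair_of_apply_ne σ hσ2 hc0 hc1 hy
  push Not at hex
  have hpow : (FiniteField.frobeniusAlgEquivOfAlgebraic k K) ^ (j * 3) = 1 := by
    ext x
    rw [pow_mul, ← hσdef]
    simpa [pow_succ] using hex x
  have hdvd := orderOf_dvd_of_pow_eq_one hpow
  rw [FiniteField.orderOf_frobeniusAlgEquivOfAlgebraic] at hdvd
  have h3 : Module.finrank k K = 3 :=
    ((Nat.dvd_prime Nat.prime_three).1 (hj.symm.dvd_of_dvd_mul_left hdvd)).resolve_left hone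
  have hunity (x : K) (hx : x ^ 3 = 1) : x ∈ Set.range (algebraMap k K) := by
    apply mem_range_algebraMap_of_pow_natCard_eq
    obtain ⟨r, hr⟩ := hk
    have : 1 < Nat.card k := Finite.one_lt_card
    rw [show Nat.card k = 3 * r + 1 by omega, pow_succ, pow_mul, hx, one_pow, one_mul]
  obtain ⟨θ, hθ, hθ3⟩ := exists_notMem_range_cube_mem h3 hk
  have hκ : c * (c + 1) ≠ 0 := by
    refine mul_ne_zero hc0 fun h ↦ hc1 ?_
    linear_combination h - CharTwo.two_eq_zero (R := k)
  obtain ⟨θ', hθ', g, hg, htr⟩ := exists_cube_mem_trace_eq_one hunity hκ hθ hθ3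
  exact hasTracePair_of_cube_mem σ hσ hodd hunity hθ' hg htr

/-- If `x ↦ x ^ u` inverts `p ↦ p σ(p)`, adding the trace to it yields a permutation. -/
theorem bijective_pow_add_trace {K : Type*} [Field K] [Finite K] [Algebra (ZMod 2) K] [CharP K 2]
    (σ : K ≃ₐ[ZMod 2] K) {u : ℕ} (hu : ∀ x : K, x ^ u * σ (x ^ u) = x)
    (htr1 : Algebra.trace (ZMod 2) K 1 = 0) :
    Function.Bijective
      (fun x : K ↦ x ^ u + algebraMap (ZMod 2) K (Algebra.trace (ZMod 2) K x)) := by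
  rw [← Finite.injective_iff_bijective]
  have two : (2 : K) = 0 := CharTwo.two_eq_zero
  intro x x' h
  dsimp only at h
  have hZ (e e' : ZMod 2) : e = e' ∨ e = e' + 1 := by revert e e'; decide
  rcases hZ (Algebra.trace (ZMod 2) K x) (Algebra.trace (ZMod 2) K x') with he | he
  · rw [he, add_left_inj] at h
    rw [← hu x, h, hu x']
  · exfalso
    rw [he, map_add, map_one] at h
    have hp : x ^ u = x' ^ u + 1 := by linear_combination h - two
    have hx : x = x' + (x' ^ u + σ (x' ^ u) + 1) := by
      conv_lhs => rw [← hu x, hp, map_add, map_one]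
      linear_combination hu x'
    have := congrArg (Algebra.trace (ZMod 2) K) hx
    simp only [map_add, htr1, Algebra.trace_eq_of_algEquiv, CharTwo.add_self_eq_zero,
      add_zero] at this
    rw [this] at he
    simp at he

/-- The map `x ↦ (x + a) ^ u + c x ^ u` is injective when `x ↦ x ^ u` inverts `p ↦ p σ(p)`
and `c ≠ 1` is fixed by `σ`. -/
theorem injective_pow_add_mul_pow {K : Type*} [Field K] [CharP K 2]
    (σ : K →+* K) {u : ℕ} (hu : ∀ x : K, x ^ u * σ (x ^ u) = x)
    (hu' : ∀ p : K, (p * σ p) ^ u = p) {c : K} (hc : σ c = c) (hc1 : c ≠ 1) (a : K) :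
    Function.Injective (fun x : K ↦ (x + a) ^ u + c * x ^ u) := by
  have two : (2 : K) = 0 := CharTwo.two_eq_zero
  have hc1' : c + 1 ≠ 0 := fun h ↦ hc1 (by linear_combination h - two)
  intro x x' h
  dsimp only at h
  obtain ⟨b, hb⟩ : ∃ b, b = (x + a) ^ u + c * x ^ u := ⟨_, rfl⟩
  obtain ⟨γ, hγ⟩ : ∃ γ, γ = c / (c + 1) ^ 2 := ⟨_, rfl⟩
  have hγ' : γ * (c + 1) ^ 2 = c := by rw [hγ]; field_simp
  have hσγ : σ γ = γ := by simp [hγ, hc]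
  have key (t : K) (ht : b = (t + a) ^ u + c * t ^ u) :
      (c + 1) ^ 2 * ((t ^ u + γ * b) * σ (t ^ u + γ * b)) =
        a + (1 + (c + 1) ^ 2 * γ ^ 2) * (b * σ b) := by
    have h1 := hu (t + a)
    have hq : (t + a) ^ u = b + c * t ^ u := by linear_combination -ht - c * t ^ u * two
    rw [hq, map_add, map_mul, hc] at h1
    rw [map_add, map_mul, hσγ]
    linear_combination h1 - hu t + (t ^ u * σ b + b * σ (t ^ u)) * hγ' +
      (c * t ^ u * σ (t ^ u) + t ^ u * σ (t ^ u) - b * σ b) * two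
  have h1 := key x hb
  have h2 := key x' (hb.trans h)
  have h3 := mul_left_cancel₀ (pow_ne_zero 2 hc1') (h1.trans h2.symm)
  have h4 := congrArg (· ^ u) h3
  simp only [hu', add_left_inj] at h4
  rw [← hu x, h4, hu x']

theorem natCard_le_two_of_pow_add_trace {K : Type*} [Field K] [CharP K 2] [Algebra (ZMod 2) K]
    (σ : K →+* K) {u : ℕ} (hu : ∀ x : K, x ^ u * σ (x ^ u) = x)
    (hu' : ∀ p : K, (p * σ p) ^ u = p) {c : K} (hc : σ c = c) (hc1 : c ≠ 1) (a b : K) :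
    Nat.card {x : K // (x + a) ^ u + algebraMap (ZMod 2) K (Algebra.trace (ZMod 2) K (x + a)) +
      c * (x ^ u + algebraMap (ZMod 2) K (Algebra.trace (ZMod 2) K x)) = b} ≤ 2 := by
  refine (Nat.card_le_card_of_injective (fun x ↦ Algebra.trace (ZMod 2) K x.1) ?_).trans_eq
    (Nat.card_zmod 2)
  rintro ⟨x, hx⟩ ⟨x', hx'⟩ h
  refine Subtype.ext (injective_pow_add_mul_pow σ hu hu' hc hc1 a ?_)
  dsimp only at h ⊢
  rw [map_add, map_add, h] at hx
  rw [map_add, map_add] at hx'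
  linear_combination hx - hx'

theorem two_le_natCard_of_hasTracePair {k K : Type*} [Field k] [Field K] [Finite K] [Algebra k K]
    [CharP K 2] [Algebra (ZMod 2) K] (σ : K ≃ₐ[k] K)
    (hσ : ∀ x, σ x = x → x ∈ Set.range (algebraMap k K)) (hodd : Odd (Module.finrank k K))
    {u : ℕ} (hu' : ∀ p : K, (p * σ p) ^ u = p) {c : K} (h : HasTracePair k σ c) :
    ∃ a b : K, 2 ≤ Nat.card {x : K //
      (x + a) ^ u + algebraMap (ZMod 2) K (Algebra.trace (ZMod 2) K (x + a)) +
        c * (x ^ u + algebraMap (ZMod 2) K (Algebra.trace (ZMod 2) K x)) = b} := by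
  have two : (2 : K) = 0 := CharTwo.two_eq_zero
  have : CharP k 2 := (Algebra.charP_iff k K 2).2 ‹_›
  obtain ⟨y, z, s, hy, hz, hyz, hsy, hsz, hs⟩ := h
  have key (y : K) (hy : y ≠ 0) (hsy : Algebra.trace k K (s * (y * σ y)⁻¹) = 1) :
      ∃ x : K, (x + s) ^ u = x ^ u + y := by
    have h0 : Algebra.trace k K (s * (y * σ y)⁻¹ + 1) = 0 := by
      rw [map_add, hsy, ← map_one (algebraMap k K), trace_algebraMap_of_odd hodd,
        CharTwo.add_self_eq_zero]
    obtain ⟨v, hv⟩ := exists_sub_eq_of_trace_eq_zero σ hσ h0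
    refine ⟨y * v * σ (y * v), ?_⟩
    have hsum : y * v * σ (y * v) + s = (y * v + y) * σ (y * v + y) := by
      have hσy : σ y ≠ 0 := by simpa using hy
      have hs' : s = y * σ y * (σ v - v - 1) := by
        rw [hv]
        field_simp
        ring
      rw [hs']
      simp only [map_add, map_mul]
      linear_combination (-y * σ y * (v + 1)) * two
    rw [hsum, hu', hu']
  obtain ⟨x₁, hx₁⟩ := key y hy hsy
  obtain ⟨x₂, hx₂⟩ := key z hz hsz
  have hs0 : s ≠ 0 := by
    rintro rfl
    simp at hs
  have hadd : x₁ + (x₁ + x₂) = x₂ := by linear_combination x₁ * two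
  have hadd' : x₁ + s + (x₁ + x₂) = x₂ + s := by linear_combination x₁ * two
  refine ⟨x₁ + x₂, x₂ ^ u + algebraMap (ZMod 2) K (Algebra.trace (ZMod 2) K x₂) +
    c * (x₁ ^ u + algebraMap (ZMod 2) K (Algebra.trace (ZMod 2) K x₁)), ?_⟩
  refine Finite.one_lt_card_iff_nontrivial.2
    ⟨⟨x₁, by rw [hadd]⟩, ⟨x₁ + s, ?_⟩, fun h ↦ hs0 ?_⟩
  · rw [hadd', hx₁, hx₂]
    simp only [map_add, hs, map_one]
    linear_combination hyz + (c * y + c) * two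
  · simpa using congrArg Subtype.val h

theorem pow_two_pow_gcd_eq_self {K : Type*} [CommRing K] [CharP K 2] {x : K} {a b : ℕ}
    (ha : x ^ 2 ^ a = x) (hb : x ^ 2 ^ b = x) : x ^ 2 ^ a.gcd b = x := by
  have hper (e : ℕ) : x ^ 2 ^ e = x ↔ Function.IsPeriodicPt (frobenius K 2) e x := by
    rw [Function.IsPeriodicPt, Function.IsFixedPt, iterate_frobenius]
  rw [hper] at *
  exact ha.gcd hb

theorem aTr_eq_algebraMap_trace {K : Type} [Field K] [Finite K] [Algebra (ZMod 2) K] {n : ℕ}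
    (hn : Module.finrank (ZMod 2) K = n) (x : K) :
    aTr n x = algebraMap (ZMod 2) K (Algebra.trace (ZMod 2) K x) := by
  rw [FiniteField.algebraMap_trace_eq_sum_pow, hn, Nat.card_zmod, aTr]

theorem aTr_sq {K : Type} [Field K] [Finite K] [Algebra (ZMod 2) K] {n : ℕ}
    (hn : Module.finrank (ZMod 2) K = n) (x : K) : aTr n x ^ 2 = aTr n x := by
  rw [aTr_eq_algebraMap_trace hn, ← map_pow, ZMod.pow_card]

/-- Squaring the values of `F` and the parameter `c` preserves the `c`-differential uniformity. -/
theorem cDelta_sq {K : Type} [Field K] [Finite K] [CharP K 2] {c : K} (hc1 : c ≠ 1) (F : K → K) :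
    cDelta (c ^ 2) (fun x ↦ F x ^ 2) = cDelta c F := by
  have hbij : Function.Bijective (frobenius K 2) := PerfectRing.bijective_frobenius
  have hc1' : c ^ 2 ≠ 1 := fun h ↦ hc1 (hbij.1 (by simpa [frobenius_def] using h))
  have hcard (a b : K) : Nat.card {x : K // F (x + a) ^ 2 + c ^ 2 * F x ^ 2 = b ^ 2} =
      Nat.card {x : K // F (x + a) + c * F x = b} := by
    refine Nat.card_congr (Equiv.subtypeEquivRight fun x ↦ ?_)
    rw [← mul_pow, ← CharTwo.add_sq]
    exact hbij.1.eq_iff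
  unfold cDelta
  congr 1
  ext j
  constructor
  · rintro ⟨a, b, -, rfl⟩
    obtain ⟨b, rfl⟩ := hbij.2 b
    exact ⟨a, b, fun h ↦ absurd h hc1, hcard a b⟩
  · rintro ⟨a, b, -, rfl⟩
    exact ⟨a, b ^ 2, fun h ↦ absurd h hc1', (hcard a b).symm⟩

theorem odd_of_gcd_two_mul_eq {n i d m : ℕ} (hd0 : d ≠ 0) (hnm : n = d * m)
    (hd2 : d = Nat.gcd (2 * i) n) (hd1 : d = Nat.gcd i n) : Odd m := by
  rw [← Nat.not_even_iff_odd]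
  rintro ⟨r, hr⟩
  have hdi : d ∣ i := hd1 ▸ Nat.gcd_dvd_left i n
  have h2 : d * 2 ∣ d := by
    conv_rhs => rw [hd2]
    refine Nat.dvd_gcd ?_ ?_
    · rw [mul_comm]
      exact mul_dvd_mul_left 2 hdi
    · rw [hnm]
      exact mul_dvd_mul_left d ⟨r, by omega⟩
  have := Nat.le_of_dvd (Nat.pos_of_ne_zero hd0) h2
  omega

theorem pow_eq_self_of_modEq {K : Type*} [Field K] [Finite K] {e : ℕ} (he : e ≠ 0)
    (h : e ≡ 1 [MOD Nat.card K - 1]) (x : K) : x ^ e = x := by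
  have : Fintype K := Fintype.ofFinite K
  obtain rfl | hx := eq_or_ne x 0
  · exact zero_pow he
  · obtain ⟨r, hr⟩ := (Nat.modEq_iff_dvd' (Nat.one_le_iff_ne_zero.2 he)).1 h.symm
    rw [show e = (Nat.card K - 1) * r + 1 by omega, pow_succ, pow_mul, Nat.card_eq_fintype_card,
      FiniteField.pow_card_sub_one_eq_one x hx, one_pow, one_mul]

/-- The map `x ^ u + tr x` is an APcN permutation. -/
theorem bijective_and_cDelta_pow_add_aTr {n i d m u : ℕ} (hnm : n = d * m) (hne : Even n)
    (hd2 : d = Nat.gcd (2 * i) n) (hd1 : d = Nat.gcd i n) (hdn : d < n)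
    (hu : ∀ x : GaloisField 2 n, (x ^ (2 ^ i + 1)) ^ u = x)
    {c : GaloisField 2 n} (hc : c ^ 2 ^ d = c) (hc0 : c ≠ 0) (hc1 : c ≠ 1) :
    Function.Bijective (fun x : GaloisField 2 n ↦ x ^ u + aTr n x) ∧
      cDelta c (fun x : GaloisField 2 n ↦ x ^ u + aTr n x) = 2 := by
  have hn0 : n ≠ 0 := by omega
  have hd0 : d ≠ 0 := by
    rintro rfl
    simp at hnm
    omega
  have hm : Odd m := odd_of_gcd_two_mul_eq hd0 hnm hd2 hd1
  have hde : Even d := (Nat.even_mul.1 (hnm ▸ hne)).resolve_right (Nat.not_even_iff_odd.2 hm)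
  have hrK := GaloisField.finrank 2 hn0
  have hrk := GaloisField.finrank 2 hd0
  obtain ⟨f⟩ := FiniteField.nonempty_algHom_of_finrank_dvd (F := ZMod 2)
    (K := GaloisField 2 d) (L := GaloisField 2 n) (by rw [hrK, hrk]; exact ⟨m, hnm⟩)
  algebraize [f.toRingHom]
  have hT : IsScalarTower (ZMod 2) (GaloisField 2 d) (GaloisField 2 n) :=
    IsScalarTower.of_algebraMap_eq fun x ↦ (f.commutes x).symm
  have hcardk : Nat.card (GaloisField 2 d) = 2 ^ d := GaloisField.card 2 d hd0
  have hfin : Module.finrank (GaloisField 2 d) (GaloisField 2 n) = m := by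
    have h := Module.finrank_mul_finrank (ZMod 2) (GaloisField 2 d) (GaloisField 2 n)
    rw [hrK, hrk] at h
    exact Nat.eq_of_mul_eq_mul_left (Nat.pos_of_ne_zero hd0) (h.trans hnm)
  have : Fintype (GaloisField 2 d) := Fintype.ofFinite _
  obtain ⟨j, hj⟩ : d ∣ i := hd1 ▸ Nat.gcd_dvd_left i n
  have hcop : j.Coprime m := by
    have h := hd1
    rw [hj, hnm, Nat.gcd_mul_left] at h
    exact Nat.eq_of_mul_eq_mul_left (Nat.pos_of_ne_zero hd0) (by rw [mul_one]; exact h.symm)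
  have hm1 : m ≠ 1 := by
    rintro rfl
    omega
  have h3 : 3 ∣ Nat.card (GaloisField 2 d) - 1 := by
    obtain ⟨r, rfl⟩ := hde
    rw [hcardk, ← two_mul, pow_mul]
    simpa using Nat.sub_dvd_pow_sub_pow 4 1 r
  obtain ⟨σ, hσ⟩ : ∃ σ, σ =
    (FiniteField.frobeniusAlgEquivOfAlgebraic (GaloisField 2 d) (GaloisField 2 n)) ^ j := ⟨_, rfl⟩
  have hσx (x : GaloisField 2 n) : σ x = x ^ 2 ^ i := by
    rw [hσ, AlgEquiv.coe_pow, FiniteField.coe_frobeniusAlgEquivOfAlgebraic_iterate,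
      ← Nat.card_eq_fintype_card, hcardk, ← pow_mul, ← hj]
  have hpn (x : GaloisField 2 n) : x ^ 2 ^ n = x := by
    have : Fintype (GaloisField 2 n) := Fintype.ofFinite _
    rw [← GaloisField.card 2 n hn0, Nat.card_eq_fintype_card, FiniteField.pow_card]
  have hmem (x : GaloisField 2 n) (hx : x ^ 2 ^ d = x) :
      x ∈ Set.range (algebraMap (GaloisField 2 d) (GaloisField 2 n)) :=
    mem_range_algebraMap_of_pow_natCard_eq (by rwa [hcardk])
  have hfix (x : GaloisField 2 n) (hx : σ x = x) :
      x ∈ Set.range (algebraMap (GaloisField 2 d) (GaloisField 2 n)) := by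
    rw [hσx] at hx
    exact hmem x (hd1 ▸ pow_two_pow_gcd_eq_self hx (hpn x))
  have hfix2 (x : GaloisField 2 n) (hx : σ (σ x) = x) :
      x ∈ Set.range (algebraMap (GaloisField 2 d) (GaloisField 2 n)) := by
    rw [hσx, hσx, ← pow_mul, ← pow_add, ← two_mul] at hx
    exact hmem x (hd2 ▸ pow_two_pow_gcd_eq_self hx (hpn x))
  obtain ⟨c', rfl⟩ := hmem c hc
  have hodd : Odd (Module.finrank (GaloisField 2 d) (GaloisField 2 n)) := hfin ▸ hm
  have hpair : HasTracePair (GaloisField 2 d) σ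
      (algebraMap (GaloisField 2 d) (GaloisField 2 n) c') := by
    subst hσ
    exact hasTracePair_of_odd_finrank hodd (hfin ▸ hm1) h3 (hfin ▸ hcop) hfix hfix2
      (by rintro rfl; simp at hc0) (by rintro rfl; simp at hc1)
  have hu1 (p : GaloisField 2 n) : (p * σ p) ^ u = p := by
    rw [hσx, ← pow_succ', hu]
  have hu2 (x : GaloisField 2 n) : x ^ u * σ (x ^ u) = x := by
    rw [hσx, ← pow_succ', ← pow_mul, mul_comm, pow_mul, hu]
  have hF : (fun x : GaloisField 2 n ↦ x ^ u + aTr n x) =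
      fun x ↦ x ^ u + algebraMap (ZMod 2) _ (Algebra.trace (ZMod 2) _ x) := by
    funext x
    rw [aTr_eq_algebraMap_trace hrK]
  have htr1 : Algebra.trace (ZMod 2) (GaloisField 2 n) 1 = 0 := by
    obtain ⟨r, hr⟩ := hne
    rw [← map_one (algebraMap (ZMod 2) _), Algebra.trace_algebraMap, hrK, hr, add_smul,
      CharTwo.add_self_eq_zero]
  rw [hF]
  refine ⟨bijective_pow_add_trace (σ.restrictScalars (ZMod 2)) hu2 htr1, ?_⟩
  have hle := natCard_le_two_of_pow_add_trace (σ : GaloisField 2 n →+* GaloisField 2 n) hu2 hu1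
    (σ.commutes c') hc1
  obtain ⟨a, b, hab⟩ := two_le_natCard_of_hasTracePair σ hfix hodd hu1 hpair
  refine IsGreatest.csSup_eq ⟨⟨a, b, fun h ↦ absurd h hc1, ?_⟩, ?_⟩
  · exact le_antisymm hab (hle a b)
  · rintro _ ⟨a, b, -, rfl⟩
    exact hle a b

/-- with `c ∈ F_{2^d} \ F_2`, `d = gcd(2i,n) = gcd(i,n) < n`,
`n = dm` even and `u ≡ (2^i+1)^{-1} mod 2^n - 1`, the map `x^u + tr(x)` is an
APcN permutation of `F_{2^n}`; equivalently, so is `x^{(2^{im}+1)/(2^i+1)} + tr(x)`. -/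
theorem stmt16 (n i d m u : ℕ) (hnm : n = d * m) (hne : Even n)
    (hd2 : d = Nat.gcd (2 * i) n) (hd1 : d = Nat.gcd i n) (hdn : d < n)
    (hu : (2 ^ i + 1) * u ≡ 1 [MOD 2 ^ n - 1])
    (c : GaloisField 2 n) (hc : c ^ 2 ^ d = c) (hc0 : c ≠ 0) (hc1 : c ≠ 1) :
    (Function.Bijective (fun x : GaloisField 2 n => x ^ u + aTr n x) ∧
      cDelta c (fun x : GaloisField 2 n => x ^ u + aTr n x) = 2) ∧
    (Function.Bijective
        (fun x : GaloisField 2 n => x ^ ((2 ^ (i * m) + 1) / (2 ^ i + 1)) + aTr n x) ∧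
      cDelta c
        (fun x : GaloisField 2 n => x ^ ((2 ^ (i * m) + 1) / (2 ^ i + 1)) + aTr n x) = 2) := by
  have hn0 : n ≠ 0 := by omega
  have hd0 : d ≠ 0 := by
    rintro rfl
    simp at hnm
    omega
  have hm : Odd m := odd_of_gcd_two_mul_eq hd0 hnm hd2 hd1
  have hcard : Nat.card (GaloisField 2 n) = 2 ^ n := GaloisField.card 2 n hn0
  have hn2 : 2 ≤ n := by
    obtain ⟨r, hr⟩ := hne
    omega
  have hpow4 : 2 ^ 2 ≤ 2 ^ n := Nat.pow_le_pow_right two_pos hn2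
  have hu0 : u ≠ 0 := by
    rintro rfl
    rw [mul_zero, Nat.modEq_iff_dvd' zero_le_one] at hu
    have := Nat.le_of_dvd one_pos hu
    omega
  have hinv (x : GaloisField 2 n) : (x ^ (2 ^ i + 1)) ^ u = x := by
    rw [← pow_mul]
    exact pow_eq_self_of_modEq (mul_ne_zero (Nat.succ_ne_zero _) hu0) (hcard ▸ hu) x
  refine ⟨bijective_and_cDelta_pow_add_aTr hnm hne hd2 hd1 hdn hinv hc hc0 hc1, ?_⟩
  have hpow (x : GaloisField 2 n) : x ^ ((2 ^ (i * m) + 1) / (2 ^ i + 1)) = (x ^ u) ^ 2 := by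
    have hdvd : 2 ^ i + 1 ∣ 2 ^ (i * m) + 1 := by
      simpa [pow_mul] using hm.nat_add_dvd_pow_add_pow (2 ^ i) 1
    obtain ⟨j, hj⟩ : n ∣ i * m := by
      rw [hnm]
      exact mul_dvd_mul_right (hd1 ▸ Nat.gcd_dvd_left i n) m
    have hx : (x ^ u) ^ (2 ^ i + 1) = x := by rw [← pow_mul, mul_comm, pow_mul, hinv]
    have : Fintype (GaloisField 2 n) := Fintype.ofFinite _
    conv_lhs => rw [← hx, ← pow_mul, Nat.mul_div_cancel' hdvd, pow_succ, hj, pow_mul, ← hcard,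
      Nat.card_eq_fintype_card, FiniteField.pow_card_pow, ← sq]
  have hF : (fun x : GaloisField 2 n ↦ x ^ ((2 ^ (i * m) + 1) / (2 ^ i + 1)) + aTr n x) =
      fun x ↦ (x ^ u + aTr n x) ^ 2 := by
    funext x
    rw [CharTwo.add_sq, aTr_sq (GaloisField.finrank 2 hn0), hpow]
  have hbij : Function.Bijective (frobenius (GaloisField 2 n) 2) :=
    PerfectRing.bijective_frobenius
  obtain ⟨e, rfl⟩ := hbij.2 c
  rw [frobenius_def] at hc hc0 hc1 ⊢
  have he : e ^ 2 ^ d = e := hbij.1 (by rw [frobenius_def, frobenius_def, pow_right_comm, hc])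
  have he1 : e ≠ 1 := by
    rintro rfl
    simp at hc1
  obtain ⟨hB, hD⟩ := bijective_and_cDelta_pow_add_aTr hnm hne hd2 hd1 hdn hinv he
    (by rintro rfl; simp at hc0) he1
  rw [hF]
  exact ⟨hbij.comp hB, (cDelta_sq he1 _).trans hD⟩
end
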